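/- Let η ≠ 0, ℓ > −3/2 with ℓ ≠ −1, n ∈ ℕ, and H ≥ 0. Then all zeros of the polynomial R_{n,ℓ,η} and all zeros of the polynomial D_{n,ℓ,η}(H; ·) are real and simple, the two polynomials have no common zero, and their real zeros strictly interlace: between any two consecutive zeros of R_{n,ℓ,η} there lies exactly one zero of D_{n,ℓ,η}(H; ·), and (when H > 0) D_{n,ℓ,η}(H; ·) has exactly one zero below the smallest and exactly one zero above the largest zero of R_{n,ℓ,η}. -/

import Mathlib

open Polynomial

/-- The recurrence coefficient α_n = −η/(2(ℓ+n+1)(ℓ+n+2)). -/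
noncomputable def alphaR (l η : ℝ) (n : ℕ) : ℝ :=
  -η / (2 * (l + n + 1) * (l + n + 2))

/-- The recurrence coefficient
β_n = ((ℓ+n+1)² + η²)/(2(2ℓ+2n+1)(2ℓ+2n+2)(2ℓ+2n+3)(ℓ+n+1)). -/
noncomputable def betaR (l η : ℝ) (n : ℕ) : ℝ :=
  ((l + n + 1) ^ 2 + η ^ 2) /
    (2 * (2 * l + 2 * n + 1) * (2 * l + 2 * n + 2) * (2 * l + 2 * n + 3) * (l + n + 1))

/-- The monic orthogonal polynomials R_{n,ℓ,η} of Wimp, defined by the three-term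
recurrence R_{n+1} = (X − α_n) R_n − β_n R_{n−1}, with R_0 = 1 and
R_1 = X + η/(2(ℓ+1)(ℓ+2)). -/
noncomputable def Rpoly (l η : ℝ) : ℕ → Polynomial ℝ
  | 0 => 1
  | 1 => X + C (η / (2 * (l + 1) * (l + 2)))
  | (n + 2) =>
      (X - C (alphaR l η (n + 1))) * Rpoly l η (n + 1) - C (betaR l η (n + 1)) * Rpoly l η n

/-- The polynomial D_{n,ℓ,η}(H; ·) = (η/(2(ℓ+1)) + H X) R_{n,ℓ,η}
− ((1 + η²/(ℓ+1)²)/(4(2ℓ+3))) R_{n−1,ℓ+1,η} (for n ≥ 1). -/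
noncomputable def Dpoly (l η H : ℝ) (n : ℕ) : Polynomial ℝ :=
  (C (η / (2 * (l + 1))) + C H * X) * Rpoly l η n -
    C ((1 + η ^ 2 / (l + 1) ^ 2) / (4 * (2 * l + 3))) * Rpoly (l + 1) η (n - 1)

/-- `P / Q` has positive imaginary part on the upper half-plane and is strictly increasing on
the real line away from its poles, expressed without division. -/
def IsHerglotzPair (P Q : ℝ[X]) : Prop :=
  (∀ x : ℝ, 0 < eval x (derivative P) * eval x Q - eval x P * eval x (derivative Q)) ∧
    ∀ z : ℂ, 0 < z.im → 0 < (aeval z P * (starRingEnd ℂ) (aeval z Q)).im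

namespace IsHerglotzPair

variable {P Q : ℝ[X]}

lemma im_eq_zero_left (h : IsHerglotzPair P Q) {z : ℂ} (hz : aeval z P = 0) : z.im = 0 := by
  rcases lt_trichotomy z.im 0 with hlt | h0 | hgt
  · have hconj : aeval ((starRingEnd ℂ) z) P = 0 := by rw [aeval_conj, hz, map_zero]
    have := h.2 ((starRingEnd ℂ) z) (by simpa using hlt)
    simp [hconj] at this
  · exact h0
  · have := h.2 z hgt
    simp [hz] at this

lemma derivative_ne_zero_left (h : IsHerglotzPair P Q) {z : ℂ} (hz : aeval z P = 0) :
    aeval z (derivative P) ≠ 0 := by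
  obtain ⟨x, rfl⟩ : ∃ x : ℝ, z = x := ⟨z.re, Complex.ext rfl (by simp [h.im_eq_zero_left hz])⟩
  have key (p : ℝ[X]) : aeval (x : ℂ) p = 0 ↔ eval x p = 0 := by
    rw [← Complex.coe_algebraMap, aeval_algebraMap_eq_zero_iff, coe_aeval_eq_eval]
  rw [key] at hz
  rw [Ne, key]
  intro hd
  have := h.1 x
  simp [hz, hd] at this

lemma not_common_zero (h : IsHerglotzPair P Q) (z : ℂ) : ¬(aeval z Q = 0 ∧ aeval z P = 0) := by
  rintro ⟨hQ, hP⟩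
  obtain ⟨x, rfl⟩ : ∃ x : ℝ, z = x := ⟨z.re, Complex.ext rfl (by simp [h.im_eq_zero_left hP])⟩
  rw [← Complex.coe_algebraMap, aeval_algebraMap_eq_zero_iff, coe_aeval_eq_eval] at hQ hP
  have := h.1 x
  simp [hQ, hP] at this

lemma linear_mul_sub (h : IsHerglotzPair P Q) {a H c : ℝ} (hH : 0 ≤ H) (hc : 0 < c) :
    IsHerglotzPair ((C a + C H * X) * P - C c * Q) P := by
  refine ⟨fun x => ?_, fun z hz => ?_⟩
  · have h1 := mul_pos hc (h.1 x)
    have h2 := mul_nonneg hH (sq_nonneg (eval x P))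
    simp
    linarith
  · have h1 := mul_pos hc (h.2 z hz)
    have h2 := mul_nonneg (mul_nonneg hH hz.le)
      (add_nonneg (sq_nonneg (aeval z P).re) (sq_nonneg (aeval z P).im))
    simp at h1 ⊢
    linarith

lemma X_add_C (a : ℝ) : IsHerglotzPair (X + C a) 1 :=
  ⟨fun x => by simp, fun z hz => by simpa using hz⟩

end IsHerglotzPair

/-- A Wronskian version of Rolle's theorem: if the Wronskian of `P` and `Q` never vanishes, then
`Q` vanishes somewhere between two zeros of `P`. -/
lemma exists_eval_eq_zero_of_wronskian_ne_zero {P Q : ℝ[X]}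
    (hW : ∀ x : ℝ, eval x (derivative P) * eval x Q - eval x P * eval x (derivative Q) ≠ 0)
    {x y : ℝ} (hxy : x < y) (hx : eval x P = 0) (hy : eval y P = 0) :
    ∃ t ∈ Set.Ioo x y, eval t Q = 0 := by
  by_contra! hne
  have hQ : ∀ t ∈ Set.Icc x y, eval t Q ≠ 0 := by
    intro t ht h0
    rcases eq_or_lt_of_le ht.1 with rfl | h1
    · exact hW x (by simp [hx, h0])
    rcases eq_or_lt_of_le ht.2 with rfl | h2
    · exact hW t (by simp [hy, h0])
    exact hne t ⟨h1, h2⟩ h0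
  obtain ⟨t, ht, hd⟩ := exists_hasDerivAt_eq_zero (f := fun t => eval t P / eval t Q) hxy
    (P.continuous.continuousOn.div Q.continuous.continuousOn hQ) (by simp [hx, hy])
    (fun t ht => (P.hasDerivAt t).div (Q.hasDerivAt t) (hQ t ⟨ht.1.le, ht.2.le⟩))
  rcases div_eq_zero_iff.1 hd with h0 | h0
  · exact hW t h0
  · exact hQ t ⟨ht.1.le, ht.2.le⟩ (pow_eq_zero_iff two_ne_zero |>.1 h0)

/-- If `D / P` is increasing off its poles and `D` has larger degree than `P`, then `D` has a zero
to the right of any zero of `P`. -/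
lemma exists_zero_gt_of_wronskian_pos {P D : ℝ[X]} (hdeg : P.degree < D.degree)
    (hW : ∀ x : ℝ, 0 < eval x (derivative D) * eval x P - eval x D * eval x (derivative P))
    {x : ℝ} (hx : eval x P = 0) : ∃ t, x < t ∧ eval t D = 0 := by
  by_contra! hne
  have hD : ∀ t ∈ Set.Ici x, eval t D ≠ 0 := by
    intro t ht h0
    rcases eq_or_lt_of_le (Set.mem_Ici.1 ht) with rfl | h1
    · have := hW x
      simp [hx, h0] at this
    · exact hne t h1 h0
  have hanti : StrictAntiOn (fun t => eval t P / eval t D) (Set.Ici x) := by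
    refine strictAntiOn_of_deriv_neg (convex_Ici x)
      (P.continuous.continuousOn.div D.continuous.continuousOn hD) fun t ht => ?_
    have ht' := hD t (interior_subset ht)
    have hd := (P.hasDerivAt t).div (D.hasDerivAt t) ht'
    change deriv ((fun t => eval t P) / fun t => eval t D) t < 0
    rw [hd.deriv]
    exact div_neg_of_neg_of_pos (by linarith [hW t]) (by positivity)
  have hlt : eval (x + 1) P / eval (x + 1) D < 0 := by
    simpa [hx] using hanti (Set.mem_Ici.2 le_rfl) (Set.mem_Ici.2 (by linarith))
      (show x < x + 1 by linarith)
  have hlim := P.div_tendsto_atTop_zero_of_degree_lt D hdeg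
  refine absurd (le_of_tendsto hlim ?_) hlt.not_ge
  filter_upwards [Filter.eventually_ge_atTop (x + 1)] with t ht
  exact hanti.antitoneOn (Set.mem_Ici.2 (by linarith)) (Set.mem_Ici.2 (by linarith)) ht

/-- If `D / P` is increasing off its poles and `D` has larger degree than `P`, then `D` has a zero
to the left of any zero of `P`. -/
lemma exists_zero_lt_of_wronskian_pos {P D : ℝ[X]} (hdeg : P.degree < D.degree)
    (hW : ∀ x : ℝ, 0 < eval x (derivative D) * eval x P - eval x D * eval x (derivative P))
    {x : ℝ} (hx : eval x P = 0) : ∃ t, t < x ∧ eval t D = 0 := by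
  obtain ⟨t, ht, h0⟩ := exists_zero_gt_of_wronskian_pos (P := -P.comp (-X)) (D := D.comp (-X))
    (x := -x) (by simpa [degree_eq_natDegree, natDegree_comp] using hdeg)
    (fun t => by have := hW (-t); simp [derivative_comp]; linarith) (by simp [hx])
  exact ⟨-t, by linarith, by simpa using h0⟩

lemma alphaR_add_one (l η : ℝ) (n : ℕ) : alphaR (l + 1) η n = alphaR l η (n + 1) := by
  unfold alphaR
  push_cast
  congr 1
  ring

lemma betaR_add_one (l η : ℝ) (n : ℕ) : betaR (l + 1) η n = betaR l η (n + 1) := by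
  unfold betaR
  push_cast
  congr 1 <;> ring

lemma Rpoly_one (l η : ℝ) : Rpoly l η 1 = X - C (alphaR l η 0) := by
  rw [Rpoly, sub_eq_add_neg, ← C_neg, alphaR]
  simp [neg_div]

lemma Rpoly_succ_succ (l η : ℝ) (n : ℕ) :
    Rpoly l η (n + 2) = (X - C (alphaR l η (n + 1))) * Rpoly l η (n + 1) -
      C (betaR l η (n + 1)) * Rpoly l η n := rfl

lemma betaR_one_pos {l : ℝ} (η : ℝ) (hl : -3/2 < l) : 0 < betaR l η 1 := by
  unfold betaR
  push_cast
  have : 0 < l + 1 + 1 := by linarith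
  have : 0 < 2 * l + 2 * 1 + 1 := by linarith
  have : 0 < 2 * l + 2 * 1 + 2 := by linarith
  have : 0 < 2 * l + 2 * 1 + 3 := by linarith
  positivity

/-- The recurrence expressing `R_{n+2,ℓ,η}` through the polynomials with shifted parameter `ℓ`. -/
lemma Rpoly_add_two (η : ℝ) (n : ℕ) (l : ℝ) :
    Rpoly l η (n + 2) = (X - C (alphaR l η 0)) * Rpoly (l + 1) η (n + 1) -
      C (betaR l η 1) * Rpoly (l + 1 + 1) η n := by
  induction n using Nat.twoStepInduction with
  | zero =>
    rw [Rpoly_succ_succ, zero_add, Rpoly_one, Rpoly_one, alphaR_add_one]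
    simp only [Rpoly]
    ring
  | one =>
    have h2 (l : ℝ) : Rpoly l η (1 + 1) =
        (X - C (alphaR l η 1)) * (X - C (alphaR l η 0)) - C (betaR l η 1) :=
      (Rpoly_succ_succ l η 0).trans (by rw [zero_add, Rpoly_one]; simp [Rpoly])
    rw [Rpoly_succ_succ, h2, h2, Rpoly_one, Rpoly_one]
    simp only [alphaR_add_one, betaR_add_one]
    ring
  | more n h1 h2 =>
    rw [Rpoly_succ_succ l, h1, h2, Rpoly_succ_succ (l + 1) η (n + 1),
      Rpoly_succ_succ (l + 1 + 1) η n]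
    simp only [alphaR_add_one, betaR_add_one]
    ring

lemma isHerglotzPair_Rpoly (η : ℝ) (n : ℕ) {l : ℝ} (hl : -3/2 < l) :
    IsHerglotzPair (Rpoly l η (n + 1)) (Rpoly (l + 1) η n) := by
  induction n generalizing l with
  | zero => exact IsHerglotzPair.X_add_C _
  | succ n ih =>
    have h := (ih (l := l + 1) (by linarith)).linear_mul_sub (a := -alphaR l η 0) zero_le_one
      (betaR_one_pos η hl)
    rw [Rpoly_add_two]
    convert h using 3
    simp
    ring

lemma degree_Rpoly (l η : ℝ) (n : ℕ) : (Rpoly l η n).degree = n := by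
  induction n using Nat.twoStepInduction with
  | zero => simp [Rpoly]
  | one => simp [Rpoly_one]
  | more n h1 h2 =>
    have hm : ((X - C (alphaR l η (n + 1))) * Rpoly l η (n + 1)).degree = ((n + 2 : ℕ) : WithBot ℕ) := by
      rw [degree_mul, degree_X_sub_C, h2]
      norm_cast
      ring
    rw [Rpoly_succ_succ, degree_sub_eq_left_of_degree_lt, hm]
    rw [hm]
    rw [← smul_eq_C_mul]
    refine ((degree_smul_le _ _).trans h1.le).trans_lt ?_
    norm_cast
    omega

lemma degree_Rpoly_lt_degree_Dpoly (l η : ℝ) {H : ℝ} (hH : 0 < H) (n : ℕ) :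
    (Rpoly l η n).degree < (Dpoly l η H n).degree := by
  have hm : ((C (η / (2 * (l + 1))) + C H * X) * Rpoly l η n).degree = ((n + 1 : ℕ) : WithBot ℕ) := by
    rw [degree_mul, add_comm (C _), degree_linear hH.ne', degree_Rpoly]
    norm_cast
    ring
  rw [Dpoly, degree_sub_eq_left_of_degree_lt, hm, degree_Rpoly]
  · norm_cast
    omega
  · rw [hm]
    rw [← smul_eq_C_mul]
    refine ((degree_smul_le _ _).trans (degree_Rpoly _ _ _).le).trans_lt ?_
    norm_cast
    omega

lemma isHerglotzPair_Dpoly (η : ℝ) {n : ℕ} (hn : 1 ≤ n) {l H : ℝ} (hl : -3/2 < l) (hH : 0 ≤ H) :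
    IsHerglotzPair (Dpoly l η H n) (Rpoly l η n) := by
  obtain ⟨m, rfl⟩ := Nat.exists_eq_add_of_le' hn
  have : 0 < 2 * l + 3 := by linarith
  exact (isHerglotzPair_Rpoly η m hl).linear_mul_sub hH (by positivity)

/-- Theorem 5.1: for H ≥ 0, the zeros of R_{n,ℓ,η} and of D_{n,ℓ,η}(H;·) are all real and
simple, the two polynomials have no common zero, their zeros interlace (exactly one zero of
D between consecutive zeros of R), and for H > 0 the polynomial D has exactly one zero below
the smallest zero of R and exactly one zero above the largest zero of R. -/
theorem stmt_13 (l η : ℝ) (hl : -3/2 < l) (hl1 : l ≠ -1) (hη : η ≠ 0)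
    (n : ℕ) (hn : 1 ≤ n) (H : ℝ) (hH : 0 ≤ H) :
    (∀ z : ℂ, aeval z (Rpoly l η n) = 0 →
        z.im = 0 ∧ aeval z (derivative (Rpoly l η n)) ≠ 0) ∧
      (∀ z : ℂ, aeval z (Dpoly l η H n) = 0 →
        z.im = 0 ∧ aeval z (derivative (Dpoly l η H n)) ≠ 0) ∧
      (∀ z : ℂ, ¬(aeval z (Rpoly l η n) = 0 ∧ aeval z (Dpoly l η H n) = 0)) ∧
      (∀ x y : ℝ, x < y → eval x (Rpoly l η n) = 0 → eval y (Rpoly l η n) = 0 →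
        (∀ t ∈ Set.Ioo x y, eval t (Rpoly l η n) ≠ 0) →
        ∃! t : ℝ, t ∈ Set.Ioo x y ∧ eval t (Dpoly l η H n) = 0) ∧
      (0 < H → ∀ x : ℝ, eval x (Rpoly l η n) = 0 →
        (∀ y : ℝ, eval y (Rpoly l η n) = 0 → x ≤ y) →
        ∃! t : ℝ, t < x ∧ eval t (Dpoly l η H n) = 0) ∧
      (0 < H → ∀ x : ℝ, eval x (Rpoly l η n) = 0 →
        (∀ y : ℝ, eval y (Rpoly l η n) = 0 → y ≤ x) →
        ∃! t : ℝ, x < t ∧ eval t (Dpoly l η H n) = 0) := by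
  have hR : ∃ Q, IsHerglotzPair (Rpoly l η n) Q := by
    obtain ⟨m, rfl⟩ := Nat.exists_eq_add_of_le' hn
    exact ⟨_, isHerglotzPair_Rpoly η m hl⟩
  obtain ⟨Q, hR⟩ := hR
  have hD := isHerglotzPair_Dpoly η hn hl hH
  have hRroot {s t : ℝ} (hst : s < t) (hs : eval s (Dpoly l η H n) = 0)
      (ht : eval t (Dpoly l η H n) = 0) : ∃ u ∈ Set.Ioo s t, eval u (Rpoly l η n) = 0 :=
    exists_eval_eq_zero_of_wronskian_ne_zero (fun x => (hD.1 x).ne') hst hs ht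
  have hunique {I : Set ℝ} (hI : I.OrdConnected) (hne : ∀ t ∈ I, eval t (Rpoly l η n) ≠ 0)
      (hex : ∃ t, t ∈ I ∧ eval t (Dpoly l η H n) = 0) :
      ∃! t, t ∈ I ∧ eval t (Dpoly l η H n) = 0 := by
    refine existsUnique_of_exists_of_unique hex ?_
    rintro s t ⟨hs, hs0⟩ ⟨ht, ht0⟩
    by_contra hst
    rcases lt_or_gt_of_ne hst with h | h
    · obtain ⟨u, hu, hu0⟩ := hRroot h hs0 ht0
      exact hne u (hI.out hs ht (Set.Ioo_subset_Icc_self hu)) hu0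
    · obtain ⟨u, hu, hu0⟩ := hRroot h ht0 hs0
      exact hne u (hI.out ht hs (Set.Ioo_subset_Icc_self hu)) hu0
  refine ⟨fun z hz => ⟨hR.im_eq_zero_left hz, hR.derivative_ne_zero_left hz⟩,
    fun z hz => ⟨hD.im_eq_zero_left hz, hD.derivative_ne_zero_left hz⟩,
    hD.not_common_zero, fun x y hxy hx hy hne => ?_, fun hpos x hx hmin => ?_,
    fun hpos x hx hmax => ?_⟩
  · exact hunique Set.ordConnected_Ioo hne <| exists_eval_eq_zero_of_wronskian_ne_zero
      (fun t h => (hD.1 t).ne' (by linarith)) hxy hx hy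
  · exact hunique Set.ordConnected_Iio (fun t ht h0 => (hmin t h0).not_gt ht)
      (exists_zero_lt_of_wronskian_pos (degree_Rpoly_lt_degree_Dpoly l η hpos n) hD.1 hx)
  · exact hunique Set.ordConnected_Ioi (fun t ht h0 => (hmax t h0).not_gt ht)
      (exists_zero_gt_of_wronskian_pos (degree_Rpoly_lt_degree_Dpoly l η hpos n) hD.1 hx)
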